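/- arXiv:2003.01666 — 8 statements merged into one kernel-verified Lean document; each statement's English description precedes it below -/
import Mathlib

section
/- Let (x_t) be iterates of a stochastic first order method (SPG or SPP) satisfying the descent recursion with constants L ≥ 0 and 𝓑 ≥ 0, run with a constant stepsize γ_t ≡ γ ∈ (0, 2/L) (with the convention 2/0 = ∞), and let F be convex. Then the averaged iterates x̂_t := (1/t) Σ_{j=0}^{t−1} x_j satisfy, for all t ≥ 1, E[F(x̂_t)] − F* ≤ R_0² / (t γ (2 − γL)) + γ𝓑² / (2 − γL), where R_0 = ‖x_0 − x̄_0‖. -/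
open MeasureTheory Finset

/-- Telescoping a recursion `r (t + 1) ≤ r t - c * d t + b` with nonnegative `r`. -/
theorem mul_sum_le_of_recursion {r d : ℕ → ℝ} {c b : ℝ} (hr : ∀ t, 0 ≤ r t)
    (h : ∀ t, r (t + 1) ≤ r t - c * d t + b) (t : ℕ) :
    c * ∑ j ∈ range t, d j ≤ r 0 + t * b := by
  have key : c * ∑ j ∈ range t, d j + r t ≤ r 0 + t * b := by
    induction t with
    | zero => simp
    | succ t ih =>
      rw [sum_range_succ, mul_add]
      push_cast
      linarith [h t]
  linarith [hr t]

/-- Jensen's inequality for the uniform average of finitely many points. -/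
theorem ConvexOn.map_inv_smul_sum_range_le {E : Type*} [AddCommGroup E] [Module ℝ E]
    {F : E → ℝ} (hF : ConvexOn ℝ Set.univ F) {t : ℕ} (ht : t ≠ 0) (y : ℕ → E) :
    F ((t : ℝ)⁻¹ • ∑ j ∈ range t, y j) ≤ (t : ℝ)⁻¹ * ∑ j ∈ range t, F (y j) := by
  have h := hF.map_sum_le (t := range t) (w := fun _ => (t : ℝ)⁻¹) (p := y)
    (fun _ _ => by positivity) (by simp [ht]) (fun _ _ => Set.mem_univ _)
  simpa only [← smul_sum, smul_eq_mul, ← mul_sum] using h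

/-- Theorem 2.3 (sublinear convergence with constant stepsize): if the iterates `x t` of a
stochastic first order method (SPG or SPP) satisfy the descent recursion with constants
`L ≥ 0`, `𝓑 ≥ 0` and constant stepsize `γ ∈ (0, 2/L)` (encoded as `0 < γ` and `γ L < 2`,
the convention `2/0 = ∞`), and `F` is convex with optimal value `Fstar` attained on the
nonempty set `Xstar` (with projection `proj` onto `Xstar`), then the averaged iterates
`x̂ t = (1/t) ∑_{j<t} x j` satisfy
`E[F(x̂ t)] - F* ≤ R0² / (t γ (2 - γ L)) + γ 𝓑² / (2 - γ L)` for all `t ≥ 1`,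
where `R0 = ‖x 0 - x̄ 0‖` (`x 0` deterministic). -/
theorem stmt_2 {m : ℕ} {Θ : Type*} [MeasurableSpace Θ]
    (μprob : Measure Θ) [IsProbabilityMeasure μprob]
    (F : EuclideanSpace ℝ (Fin m) → ℝ)
    (hFconv : ConvexOn ℝ Set.univ F)
    (Xstar : Set (EuclideanSpace ℝ (Fin m))) (hXne : Xstar.Nonempty)
    (Fstar : ℝ)
    (hFstar : ∀ z ∈ Xstar, F z = Fstar)
    (hFmin : ∀ y, Fstar ≤ F y)
    (proj : EuclideanSpace ℝ (Fin m) → EuclideanSpace ℝ (Fin m))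
    (hprojmem : ∀ x, proj x ∈ Xstar)
    (hprojdist : ∀ x, ∀ z ∈ Xstar, ‖x - proj x‖ ≤ ‖x - z‖)
    (x : ℕ → Θ → EuclideanSpace ℝ (Fin m))
    (x0 : EuclideanSpace ℝ (Fin m)) (hx0 : ∀ θ, x 0 θ = x0)
    (hmeas : ∀ t, Measurable (x t))
    (hintdist : ∀ t, Integrable (fun θ => ‖x t θ - proj (x t θ)‖ ^ 2) μprob)
    (hintF : ∀ t, Integrable (fun θ => F (x t θ)) μprob)
    (hintavg : ∀ t : ℕ,
      Integrable (fun θ => F ((t : ℝ)⁻¹ • ∑ j ∈ range t, x j θ)) μprob)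
    (L 𝓑 γ : ℝ) (hL : 0 ≤ L) (h𝓑 : 0 ≤ 𝓑)
    (hγpos : 0 < γ) (hγlt : γ * L < 2)
    (hrec : ∀ t : ℕ,
      ∫ θ, ‖x (t + 1) θ - proj (x (t + 1) θ)‖ ^ 2 ∂μprob ≤
        ∫ θ, ‖x t θ - proj (x t θ)‖ ^ 2 ∂μprob
          - γ * (2 - γ * L) * ∫ θ, (F (x t θ) - F (proj (x t θ))) ∂μprob
          + γ ^ 2 * 𝓑 ^ 2) :
    ∀ t : ℕ, 1 ≤ t →
      (∫ θ, F ((t : ℝ)⁻¹ • ∑ j ∈ range t, x j θ) ∂μprob) - Fstar ≤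
        ‖x0 - proj x0‖ ^ 2 / ((t : ℝ) * γ * (2 - γ * L))
          + γ * 𝓑 ^ 2 / (2 - γ * L) := by
  intro t ht
  have ht0 : (0 : ℝ) < t := by exact_mod_cast ht
  have hc : 0 < 2 - γ * L := by linarith
  have hgap : ∀ j, ∫ θ, (F (x j θ) - F (proj (x j θ))) ∂μprob
      = (∫ θ, F (x j θ) ∂μprob) - Fstar := fun j => by
    simp_rw [fun θ => hFstar _ (hprojmem (x j θ))]
    rw [integral_sub (hintF j) (integrable_const _)]
    simp
  have hzero : ∫ θ, ‖x 0 θ - proj (x 0 θ)‖ ^ 2 ∂μprob = ‖x0 - proj x0‖ ^ 2 := by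
    simp [hx0]
  have htel := mul_sum_le_of_recursion
    (r := fun t => ∫ θ, ‖x t θ - proj (x t θ)‖ ^ 2 ∂μprob)
    (fun _ => integral_nonneg fun _ => by positivity) hrec t
  simp only [hgap, hzero, sum_sub_distrib, sum_const, card_range, nsmul_eq_mul] at htel
  have hjensen : ∫ θ, F ((t : ℝ)⁻¹ • ∑ j ∈ range t, x j θ) ∂μprob
      ≤ (t : ℝ)⁻¹ * ∑ j ∈ range t, ∫ θ, F (x j θ) ∂μprob := by
    rw [← integral_finsetSum _ fun j _ => hintF j, ← integral_const_mul]
    exact integral_mono (hintavg t) ((integrable_finsetSum _ fun j _ => hintF j).const_mul _)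
      fun θ => hFconv.map_inv_smul_sum_range_le (by lia) fun j => x j θ
  calc _ ≤ (t : ℝ)⁻¹ * ∑ j ∈ range t, (∫ θ, F (x j θ) ∂μprob) - Fstar := by linarith
    _ = (γ * (2 - γ * L) * (∑ j ∈ range t, (∫ θ, F (x j θ) ∂μprob) - t * Fstar))
        / (t * γ * (2 - γ * L)) := by
      field_simp
    _ ≤ (‖x0 - proj x0‖ ^ 2 + t * (γ ^ 2 * 𝓑 ^ 2)) / (t * γ * (2 - γ * L)) := by
      gcongr
    _ = _ := by
      field_simp
end

section
/- Let (x_t) be iterates of a stochastic first order method (SPG or SPP) satisfying the descent recursion with constants L ≥ 0 and 𝓑 = 0, and let F be convex. Then for any constant stepsize γ ∈ (0, 2/L) and any T ≥ 1, the averaged iterate x̂_T := (1/T) Σ_{j=0}^{T−1} x_j satisfies the O(1/T) rate E[F(x̂_T)] − F* ≤ R_0² / (T γ (2 − γL)), where R_0 = ‖x_0 − x̄_0‖. -/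
open MeasureTheory Finset

/-- Jensen's inequality for the uniform average of finitely many points. -/
lemma ConvexOn.map_average_range_le {E : Type*} [AddCommGroup E] [Module ℝ E] {f : E → ℝ}
    (hf : ConvexOn ℝ Set.univ f) (v : ℕ → E) {T : ℕ} (hT : T ≠ 0) :
    f ((T : ℝ)⁻¹ • ∑ j ∈ range T, v j) ≤ (T : ℝ)⁻¹ * ∑ j ∈ range T, f (v j) := by
  have h := hf.map_sum_le (t := range T) (w := fun _ => (T : ℝ)⁻¹) (p := v)
    (fun _ _ => by positivity) (by simp [hT]) (fun _ _ => Set.mem_univ _)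
  simpa only [← smul_sum, smul_eq_mul, ← mul_sum] using h

/-- Telescoping a descent recursion `d (t + 1) ≤ d t - c * a t`. -/
lemma mul_sum_range_le_of_descent {d a : ℕ → ℝ} {c : ℝ}
    (h : ∀ t, d (t + 1) ≤ d t - c * a t) (T : ℕ) :
    c * ∑ t ∈ range T, a t ≤ d 0 - d T := by
  rw [mul_sum, ← sum_range_sub']
  exact sum_le_sum fun t _ => by linarith [h t]

/-- Theorem 2.3, O(1/T) rate in the noiseless case `𝓑 = 0`: if the iterates of SPG/SPP
satisfy the descent recursion with constants `L ≥ 0` and `𝓑 = 0`, `F` is convex, and the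
method is run with constant stepsize `γ ∈ (0, 2/L)` (encoded as `0 < γ`, `γ L < 2`), then
for any `T ≥ 1` the averaged iterate satisfies
`E[F(x̂ T)] - F* ≤ R0² / (T γ (2 - γ L))`. -/
theorem stmt_4 {m : ℕ} {Θ : Type*} [MeasurableSpace Θ]
    (μprob : Measure Θ) [IsProbabilityMeasure μprob]
    (F : EuclideanSpace ℝ (Fin m) → ℝ)
    (hFconv : ConvexOn ℝ Set.univ F)
    (Xstar : Set (EuclideanSpace ℝ (Fin m))) (hXne : Xstar.Nonempty)
    (Fstar : ℝ)
    (hFstar : ∀ z ∈ Xstar, F z = Fstar)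
    (hFmin : ∀ y, Fstar ≤ F y)
    (proj : EuclideanSpace ℝ (Fin m) → EuclideanSpace ℝ (Fin m))
    (hprojmem : ∀ x, proj x ∈ Xstar)
    (hprojdist : ∀ x, ∀ z ∈ Xstar, ‖x - proj x‖ ≤ ‖x - z‖)
    (x : ℕ → Θ → EuclideanSpace ℝ (Fin m))
    (x0 : EuclideanSpace ℝ (Fin m)) (hx0 : ∀ θ, x 0 θ = x0)
    (hmeas : ∀ t, Measurable (x t))
    (hintdist : ∀ t, Integrable (fun θ => ‖x t θ - proj (x t θ)‖ ^ 2) μprob)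
    (hintF : ∀ t, Integrable (fun θ => F (x t θ)) μprob)
    (hintavg : ∀ t : ℕ,
      Integrable (fun θ => F ((t : ℝ)⁻¹ • ∑ j ∈ range t, x j θ)) μprob)
    (L γ : ℝ) (hL : 0 ≤ L)
    (hγpos : 0 < γ) (hγlt : γ * L < 2)
    (hrec : ∀ t : ℕ,
      ∫ θ, ‖x (t + 1) θ - proj (x (t + 1) θ)‖ ^ 2 ∂μprob ≤
        ∫ θ, ‖x t θ - proj (x t θ)‖ ^ 2 ∂μprob
          - γ * (2 - γ * L) * ∫ θ, (F (x t θ) - F (proj (x t θ))) ∂μprob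
          + γ ^ 2 * (0 : ℝ) ^ 2) :
    ∀ T : ℕ, 1 ≤ T →
      (∫ θ, F ((T : ℝ)⁻¹ • ∑ j ∈ range T, x j θ) ∂μprob) - Fstar ≤
        ‖x0 - proj x0‖ ^ 2 / ((T : ℝ) * γ * (2 - γ * L)) := by
  intro T hT
  have hT0 : (0 : ℝ) < T := by exact_mod_cast hT
  have hc : 0 < 2 - γ * L := by linarith
  have hgap : ∀ t, ∫ θ, (F (x t θ) - F (proj (x t θ))) ∂μprob
      = (∫ θ, F (x t θ) ∂μprob) - Fstar := by
    intro t
    simp_rw [fun θ => hFstar _ (hprojmem (x t θ))]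
    rw [integral_sub (hintF t) (integrable_const _)]
    simp
  have htel := mul_sum_range_le_of_descent
    (d := fun t => ∫ θ, ‖x t θ - proj (x t θ)‖ ^ 2 ∂μprob)
    (a := fun t => (∫ θ, F (x t θ) ∂μprob) - Fstar) (c := γ * (2 - γ * L))
    (fun t => by simpa [hgap t] using hrec t) T
  have hd0 : ∫ θ, ‖x 0 θ - proj (x 0 θ)‖ ^ 2 ∂μprob = ‖x0 - proj x0‖ ^ 2 := by
    simp [hx0]
  have hdT : 0 ≤ ∫ θ, ‖x T θ - proj (x T θ)‖ ^ 2 ∂μprob :=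
    integral_nonneg fun θ => by positivity
  have havg : ∫ θ, F ((T : ℝ)⁻¹ • ∑ j ∈ range T, x j θ) ∂μprob
      ≤ (T : ℝ)⁻¹ * ∑ j ∈ range T, ∫ θ, F (x j θ) ∂μprob := by
    rw [← integral_finsetSum _ fun j _ => hintF j, ← integral_const_mul]
    exact integral_mono (hintavg T)
      ((integrable_finsetSum _ fun j _ => hintF j).const_mul _)
      fun θ => hFconv.map_average_range_le (fun j => x j θ) (by omega)
  simp only [sum_sub_distrib, sum_const, card_range, nsmul_eq_mul, hd0] at htel
  rw [inv_mul_eq_div, le_div_iff₀ hT0] at havg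
  rw [le_div_iff₀ (by positivity)]
  have hcγ : 0 ≤ γ * (2 - γ * L) := by positivity
  linarith [mul_le_mul_of_nonneg_left havg hcγ]
end

section
/- Let (x_t) be iterates of a stochastic first order method (SPG or SPP) satisfying the descent recursion with constants L ≥ 0 and 𝓑 ≥ 0, and assume the quadratic functional growth condition holds with constant μ > 0. Run with constant stepsize γ ∈ (0, 2/L) and set ρ := 1 − μγ + μLγ²/2. If ρ > −1, then for all t ≥ 0, E[‖x_t − x̄_t‖²] ≤ |ρ|^t R_0² + 𝓑²γ² / (1 − |ρ|), where R_0 = ‖x_0 − x̄_0‖; i.e., the iterates converge linearly up to a noise-dominated region of radius proportional to γ². -/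
open MeasureTheory

/-- A nonnegative-ratio affine recursion `a (t + 1) ≤ r * a t + c` with `r < 1` is bounded by a
geometric term plus the fixed point `c / (1 - r)`. -/
theorem le_pow_mul_add_div_of_le_mul_add {a : ℕ → ℝ} {r c : ℝ} (hr0 : 0 ≤ r) (hr1 : r < 1)
    (hc : 0 ≤ c) (ha : ∀ t, a (t + 1) ≤ r * a t + c) (t : ℕ) :
    a t ≤ r ^ t * a 0 + c / (1 - r) := by
  have h1r : 0 < 1 - r := sub_pos.2 hr1
  induction t with
  | zero => simpa using div_nonneg hc h1r.le
  | succ t ih =>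
    calc a (t + 1) ≤ r * a t + c := ha t
      _ ≤ r * (r ^ t * a 0 + c / (1 - r)) + c := by gcongr
      _ = r ^ (t + 1) * a 0 + c / (1 - r) := by field_simp; ring

/-- Theorem 2.5 (linear convergence up to a noise-dominated region): if the iterates of
SPG/SPP satisfy the descent recursion with constants `L ≥ 0`, `𝓑 ≥ 0`, `F` satisfies the
quadratic functional growth condition with `μ > 0`, the constant stepsize satisfies
`γ ∈ (0, 2/L)` (encoded `0 < γ`, `γ L < 2`), and `ρ = 1 - μ γ + μ L γ²/2 > -1`, then
`E[‖x t - x̄ t‖²] ≤ |ρ|^t R0² + 𝓑² γ² / (1 - |ρ|)` for all `t ≥ 0`. -/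
theorem stmt_6 {m : ℕ} {Θ : Type*} [MeasurableSpace Θ]
    (μprob : Measure Θ) [IsProbabilityMeasure μprob]
    (F : EuclideanSpace ℝ (Fin m) → ℝ)
    (Xstar : Set (EuclideanSpace ℝ (Fin m))) (hXne : Xstar.Nonempty)
    (Fstar : ℝ)
    (hFstar : ∀ z ∈ Xstar, F z = Fstar)
    (hFmin : ∀ y, Fstar ≤ F y)
    (proj : EuclideanSpace ℝ (Fin m) → EuclideanSpace ℝ (Fin m))
    (hprojmem : ∀ x, proj x ∈ Xstar)
    (hprojdist : ∀ x, ∀ z ∈ Xstar, ‖x - proj x‖ ≤ ‖x - z‖)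
    (μ : ℝ) (hμ : 0 < μ)
    (hgrowth : ∀ z, μ / 2 * ‖z - proj z‖ ^ 2 ≤ F z - F (proj z))
    (x : ℕ → Θ → EuclideanSpace ℝ (Fin m))
    (x0 : EuclideanSpace ℝ (Fin m)) (hx0 : ∀ θ, x 0 θ = x0)
    (hmeas : ∀ t, Measurable (x t))
    (hintdist : ∀ t, Integrable (fun θ => ‖x t θ - proj (x t θ)‖ ^ 2) μprob)
    (hintF : ∀ t, Integrable (fun θ => F (x t θ)) μprob)
    (L 𝓑 γ : ℝ) (hL : 0 ≤ L) (h𝓑 : 0 ≤ 𝓑)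
    (hγpos : 0 < γ) (hγlt : γ * L < 2)
    (hrec : ∀ t : ℕ,
      ∫ θ, ‖x (t + 1) θ - proj (x (t + 1) θ)‖ ^ 2 ∂μprob ≤
        ∫ θ, ‖x t θ - proj (x t θ)‖ ^ 2 ∂μprob
          - γ * (2 - γ * L) * ∫ θ, (F (x t θ) - F (proj (x t θ))) ∂μprob
          + γ ^ 2 * 𝓑 ^ 2)
    (ρ : ℝ) (hρ : ρ = 1 - μ * γ + μ * L * γ ^ 2 / 2) (hρgt : -1 < ρ) :
    ∀ t : ℕ,
      ∫ θ, ‖x t θ - proj (x t θ)‖ ^ 2 ∂μprob ≤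
        |ρ| ^ t * ‖x0 - proj x0‖ ^ 2 + 𝓑 ^ 2 * γ ^ 2 / (1 - |ρ|) := by
  have hstep : 0 < γ * (2 - γ * L) := mul_pos hγpos (by linarith)
  have hρlt : ρ < 1 := by nlinarith [mul_pos hμ hstep]
  have hrec' : ∀ t : ℕ, ∫ θ, ‖x (t + 1) θ - proj (x (t + 1) θ)‖ ^ 2 ∂μprob ≤
      |ρ| * ∫ θ, ‖x t θ - proj (x t θ)‖ ^ 2 ∂μprob + 𝓑 ^ 2 * γ ^ 2 := by
    intro t
    have hintgap : Integrable (fun θ => F (x t θ) - F (proj (x t θ))) μprob := by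
      simp only [hFstar _ (hprojmem _)]
      exact (hintF t).sub (integrable_const Fstar)
    have hgap : μ / 2 * ∫ θ, ‖x t θ - proj (x t θ)‖ ^ 2 ∂μprob ≤
        ∫ θ, (F (x t θ) - F (proj (x t θ))) ∂μprob := by
      rw [← integral_const_mul]
      exact integral_mono ((hintdist t).const_mul _) hintgap fun θ => hgrowth (x t θ)
    have hdist : 0 ≤ ∫ θ, ‖x t θ - proj (x t θ)‖ ^ 2 ∂μprob :=
      integral_nonneg fun θ => by positivity
    calc _ ≤ _ := hrec t
      _ ≤ ∫ θ, ‖x t θ - proj (x t θ)‖ ^ 2 ∂μprob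
          - γ * (2 - γ * L) * (μ / 2 * ∫ θ, ‖x t θ - proj (x t θ)‖ ^ 2 ∂μprob)
          + γ ^ 2 * 𝓑 ^ 2 := by gcongr
      _ = ρ * ∫ θ, ‖x t θ - proj (x t θ)‖ ^ 2 ∂μprob + 𝓑 ^ 2 * γ ^ 2 := by rw [hρ]; ring
      _ ≤ _ := by gcongr; exact le_abs_self ρ
  intro t
  have hnoise : 0 ≤ 𝓑 ^ 2 * γ ^ 2 := by positivity
  simpa [hx0] using le_pow_mul_add_div_of_le_mul_add
    (a := fun t => ∫ θ, ‖x t θ - proj (x t θ)‖ ^ 2 ∂μprob)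
    (abs_nonneg ρ) (abs_lt.2 ⟨hρgt, hρlt⟩) hnoise hrec' t
end

section
/- Let (x_t) be iterates of a stochastic first order method (SPG or SPP) satisfying the descent recursion with constants L ≥ 0 and 𝓑 = 0 (the strong stochastic bounded gradient case), and assume the quadratic functional growth condition holds with constant μ > 0. Run with constant stepsize γ ∈ (0, 2/L) such that |1 − μγ + μLγ²/2| < 1. Then the iterates converge purely linearly: E[‖x_t − x̄_t‖²] ≤ |1 − μγ + μLγ²/2|^t R_0² for all t ≥ 0, where R_0 = ‖x_0 − x̄_0‖. -/
open MeasureTheory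

/-- Theorem 2.5 (pure linear convergence in the strong stochastic bounded gradient case
`𝓑 = 0`): if the iterates of SPG/SPP satisfy the descent recursion with constants `L ≥ 0`
and `𝓑 = 0`, `F` satisfies the quadratic functional growth condition with `μ > 0`, and
the constant stepsize `γ ∈ (0, 2/L)` (encoded `0 < γ`, `γ L < 2`) is such that
`|1 - μ γ + μ L γ²/2| < 1`, then `E[‖x t - x̄ t‖²] ≤ |1 - μ γ + μ L γ²/2|^t R0²`
for all `t ≥ 0`. -/
theorem stmt_8 {m : ℕ} {Θ : Type*} [MeasurableSpace Θ]
    (μprob : Measure Θ) [IsProbabilityMeasure μprob]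
    (F : EuclideanSpace ℝ (Fin m) → ℝ)
    (Xstar : Set (EuclideanSpace ℝ (Fin m))) (hXne : Xstar.Nonempty)
    (Fstar : ℝ)
    (hFstar : ∀ z ∈ Xstar, F z = Fstar)
    (hFmin : ∀ y, Fstar ≤ F y)
    (proj : EuclideanSpace ℝ (Fin m) → EuclideanSpace ℝ (Fin m))
    (hprojmem : ∀ x, proj x ∈ Xstar)
    (hprojdist : ∀ x, ∀ z ∈ Xstar, ‖x - proj x‖ ≤ ‖x - z‖)
    (μ : ℝ) (hμ : 0 < μ)
    (hgrowth : ∀ z, μ / 2 * ‖z - proj z‖ ^ 2 ≤ F z - F (proj z))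
    (x : ℕ → Θ → EuclideanSpace ℝ (Fin m))
    (x0 : EuclideanSpace ℝ (Fin m)) (hx0 : ∀ θ, x 0 θ = x0)
    (hmeas : ∀ t, Measurable (x t))
    (hintdist : ∀ t, Integrable (fun θ => ‖x t θ - proj (x t θ)‖ ^ 2) μprob)
    (hintF : ∀ t, Integrable (fun θ => F (x t θ)) μprob)
    (L γ : ℝ) (hL : 0 ≤ L)
    (hγpos : 0 < γ) (hγlt : γ * L < 2)
    (hrec : ∀ t : ℕ,
      ∫ θ, ‖x (t + 1) θ - proj (x (t + 1) θ)‖ ^ 2 ∂μprob ≤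
        ∫ θ, ‖x t θ - proj (x t θ)‖ ^ 2 ∂μprob
          - γ * (2 - γ * L) * ∫ θ, (F (x t θ) - F (proj (x t θ))) ∂μprob
          + γ ^ 2 * (0 : ℝ) ^ 2)
    (hρ : |1 - μ * γ + μ * L * γ ^ 2 / 2| < 1) :
    ∀ t : ℕ,
      ∫ θ, ‖x t θ - proj (x t θ)‖ ^ 2 ∂μprob ≤
        |1 - μ * γ + μ * L * γ ^ 2 / 2| ^ t * ‖x0 - proj x0‖ ^ 2 := by
  have hgap_int : ∀ t, Integrable (fun θ => F (x t θ) - F (proj (x t θ))) μprob := by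
    intro t
    simp only [hFstar _ (hprojmem _)]
    exact (hintF t).sub (integrable_const Fstar)
  have hgap : ∀ t, μ / 2 * ∫ θ, ‖x t θ - proj (x t θ)‖ ^ 2 ∂μprob ≤
      ∫ θ, (F (x t θ) - F (proj (x t θ))) ∂μprob := by
    intro t
    rw [← integral_const_mul]
    exact integral_mono ((hintdist t).const_mul _) (hgap_int t) fun θ => hgrowth (x t θ)
  intro t
  induction t with
  | zero => simp [hx0]
  | succ t ih =>
    have hnonneg : 0 ≤ ∫ θ, ‖x t θ - proj (x t θ)‖ ^ 2 ∂μprob :=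
      integral_nonneg fun θ => sq_nonneg _
    have hstep : 0 ≤ γ * (2 - γ * L) := mul_nonneg hγpos.le (by linarith)
    calc ∫ θ, ‖x (t + 1) θ - proj (x (t + 1) θ)‖ ^ 2 ∂μprob
        ≤ (1 - μ * γ + μ * L * γ ^ 2 / 2) * ∫ θ, ‖x t θ - proj (x t θ)‖ ^ 2 ∂μprob := by
          linarith [hrec t, mul_le_mul_of_nonneg_left (hgap t) hstep]
      _ ≤ |1 - μ * γ + μ * L * γ ^ 2 / 2| * ∫ θ, ‖x t θ - proj (x t θ)‖ ^ 2 ∂μprob :=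
          mul_le_mul_of_nonneg_right (le_abs_self _) hnonneg
      _ ≤ |1 - μ * γ + μ * L * γ ^ 2 / 2| *
            (|1 - μ * γ + μ * L * γ ^ 2 / 2| ^ t * ‖x0 - proj x0‖ ^ 2) :=
          mul_le_mul_of_nonneg_left ih (abs_nonneg _)
      _ = |1 - μ * γ + μ * L * γ ^ 2 / 2| ^ (t + 1) * ‖x0 - proj x0‖ ^ 2 := by ring
end

section
/- Necessary condition for linear convergence of SGD: assume g ≡ 0, f satisfies the quadratic functional growth condition with constant μ > 0, each f(·,ξ) has L_f-Lipschitz continuous gradient, and the SGD iterates x_{t+1} = x_t − γ ∇f(x_t,ξ_t) with constant stepsize γ > 0 satisfy, for some q < 1, the conditional contraction E_{ξ_t}[‖x_{t+1} − x̄_{t+1}‖² | ξ_{[t−1]}] ≤ q ‖x_t − x̄_t‖² for all t ≥ 0, and the iterates have almost surely the same projection onto the optimal set: x̄_t = x̄_0 for all t ≥ 0. Then E_ξ[‖∇f(x̄_0,ξ)‖²] = 0, i.e., the stochastic bounded gradient condition holds with B = 0 and all the partial functions f(·,ξ) have x̄_0 as a common minimizer. -/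
open MeasureTheory
open Filter Topology

section Helpers

/-- Iterates driven by a sequence depend only on the past of that sequence, so each of them can
be followed by any single step. -/
theorem exists_iterate_eq_step {E Ω : Type*} {step : E → Ω → E} {x : ℕ → (ℕ → Ω) → E}
    {x₀ : E} (h0 : ∀ ω, x 0 ω = x₀) (hstep : ∀ t ω, x (t + 1) ω = step (x t ω) (ω t))
    (t : ℕ) (ω : ℕ → Ω) (ξ : Ω) : ∃ ω', x (t + 1) ω' = step (x t ω) ξ := by
  have hpast : ∀ n (ω ω' : ℕ → Ω), (∀ i < n, ω i = ω' i) → x n ω = x n ω' := by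
    intro n
    induction n with
    | zero => intro ω ω' _; rw [h0, h0]
    | succ n ih =>
      intro ω ω' h
      rw [hstep, hstep, ih ω ω' fun i hi => h i (hi.trans n.lt_succ_self), h n n.lt_succ_self]
  refine ⟨Function.update ω t ξ, ?_⟩
  rw [hstep, Function.update_self, hpast t (Function.update ω t ξ) ω fun i hi =>
    Function.update_of_ne hi.ne _ _]

/-- If one step of `z ↦ z - γ • d z ξ` from `z` contracts the mean squared distance to `p`, then
the second moment of `d p` is at most of the order of the squared distance from `z` to `p`. -/
theorem integral_sq_norm_le_of_contraction {E Ω : Type*} [NormedAddCommGroup E]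
    [NormedSpace ℝ E] [MeasurableSpace Ω] {P : Measure Ω} [IsProbabilityMeasure P]
    {d : E → Ω → E} {L γ q : ℝ} (hγ : 0 < γ) {z p : E}
    (hLip : ∀ ω, ‖d z ω - d p ω‖ ≤ L * ‖z - p‖)
    (hsq : Integrable (fun ω => ‖d p ω‖ ^ 2) P)
    (hint : Integrable (fun ω => ‖z - γ • d z ω - p‖ ^ 2) P)
    (hcontr : ∫ ω, ‖z - γ • d z ω - p‖ ^ 2 ∂P ≤ q * ‖z - p‖ ^ 2) :
    γ ^ 2 * ∫ ω, ‖d p ω‖ ^ 2 ∂P ≤ 2 * (q + (1 + γ * L) ^ 2) * ‖z - p‖ ^ 2 := by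
  have hle : ∫ ω, γ ^ 2 * ‖d p ω‖ ^ 2 ∂P ≤
      ∫ ω, (2 * ‖z - γ • d z ω - p‖ ^ 2 + 2 * ((1 + γ * L) * ‖z - p‖) ^ 2) ∂P := by
    refine integral_mono (hsq.const_mul _) ((hint.const_mul _).add (integrable_const _))
      fun ω => ?_
    have heq : γ • d p ω = (z - p) - γ • (d z ω - d p ω) - (z - γ • d z ω - p) := by
      rw [smul_sub]; abel
    have h1 : γ * ‖d p ω‖ ≤ ‖z - γ • d z ω - p‖ + (1 + γ * L) * ‖z - p‖ := by
      have h2 : ‖γ • d p ω‖ ≤ ‖z - p‖ + ‖γ • (d z ω - d p ω)‖ + ‖z - γ • d z ω - p‖ := by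
        rw [heq]
        exact (norm_sub_le _ _).trans (by gcongr; exact norm_sub_le _ _)
      rw [norm_smul, norm_smul, Real.norm_of_nonneg hγ.le] at h2
      nlinarith [mul_le_mul_of_nonneg_left (hLip ω) hγ.le]
    have h3 := pow_le_pow_left₀ (by positivity) h1 2
    dsimp only
    nlinarith [sq_nonneg (‖z - γ • d z ω - p‖ - (1 + γ * L) * ‖z - p‖)]
  rw [integral_const_mul, integral_add (hint.const_mul _) (integrable_const _),
    integral_const_mul, integral_const] at hle
  simp only [probReal_univ, smul_eq_mul, one_mul] at hle
  nlinarith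

variable {E : Type*} [NormedAddCommGroup E] [InnerProductSpace ℝ E] [CompleteSpace E]
  {Ω : Type*}

theorem HasGradientAt.hasDerivAt_comp_add_smul {g : E → ℝ} {p v w : E} {s : ℝ}
    (h : HasGradientAt g w (p + s • v)) :
    HasDerivAt (fun r : ℝ => g (p + r • v)) (inner ℝ w v) s := by
  have hline : HasDerivAt (fun r : ℝ => p + r • v) v s := by
    simpa using ((hasDerivAt_id s).smul_const v).const_add p
  simpa [Function.comp_def] using h.hasFDerivAt.comp_hasDerivAt s hline

/-- A function with Lipschitz gradient grows at most quadratically. -/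
theorem abs_sub_le_of_lipschitz_gradient {g : E → ℝ} {dg : E → E} {L : ℝ} (hL : 0 ≤ L)
    (hg : ∀ z, HasGradientAt g (dg z) z) (hLip : ∀ z y, ‖dg z - dg y‖ ≤ L * ‖z - y‖) (p y : E) :
    |g y - g p| ≤ (‖dg p‖ + L * ‖y - p‖) * ‖y - p‖ := by
  have hbound : ∀ z ∈ Metric.closedBall p ‖y - p‖,
      ‖InnerProductSpace.toDual ℝ E (dg z)‖ ≤ ‖dg p‖ + L * ‖y - p‖ := by
    intro z hz
    rw [LinearIsometryEquiv.norm_map]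
    have h1 : ‖dg z‖ ≤ ‖dg p‖ + ‖dg z - dg p‖ := norm_le_insert' _ _
    have h2 : L * ‖z - p‖ ≤ L * ‖y - p‖ :=
      mul_le_mul_of_nonneg_left (mem_closedBall_iff_norm.1 hz) hL
    linarith [hLip z p]
  have := (convex_closedBall p ‖y - p‖).norm_image_sub_le_of_norm_hasFDerivWithin_le
    (fun z _ => (hg z).hasFDerivAt.hasFDerivWithinAt) hbound
    (Metric.mem_closedBall_self (norm_nonneg _)) (mem_closedBall_iff_norm.2 le_rfl)
  simpa [Real.norm_eq_abs] using this

variable [MeasurableSpace Ω] {P : Measure Ω}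

/-- The gradient of a random function is measurable wherever the function is measurable nearby. -/
theorem aestronglyMeasurable_gradient [FiniteDimensional ℝ E] {f : E → Ω → ℝ} {w : Ω → E} {z : E}
    (hgrad : ∀ ω, HasGradientAt (fun y => f y ω) (w ω) z)
    (hmeas : ∀ᶠ y in 𝓝 z, AEStronglyMeasurable (f y) P) : AEStronglyMeasurable w P := by
  have hinner : ∀ v : E, AEStronglyMeasurable (fun ω => inner ℝ (w ω) v) P := by
    intro v
    have hline : Tendsto (fun r : ℝ => z + r • v) (𝓝[≠] 0) (𝓝 z) := by
      have : Continuous (fun r : ℝ => z + r • v) := by fun_prop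
      simpa using (this.tendsto 0).mono_left nhdsWithin_le_nhds
    obtain ⟨u, hu⟩ := exists_seq_tendsto (𝓝[≠] (0 : ℝ))
    obtain ⟨N, hN⟩ := eventually_atTop.1 ((hline.comp hu).eventually hmeas)
    have hu' : Tendsto (fun n => u (n + N)) atTop (𝓝[≠] 0) := (tendsto_add_atTop_iff_nat N).2 hu
    refine aestronglyMeasurable_of_tendsto_ae atTop
      (f := fun n ω => (u (n + N))⁻¹ * (f (z + u (n + N) • v) ω - f z ω)) ?_ ?_
    · intro n
      exact ((hN (n + N) (Nat.le_add_left _ _)).sub hmeas.self_of_nhds).const_mul _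
    · refine Eventually.of_forall fun ω => ?_
      have hd : HasDerivAt (fun r : ℝ => f (z + r • v) ω) (inner ℝ (w ω) v) 0 :=
        HasGradientAt.hasDerivAt_comp_add_smul (g := fun y => f y ω) (by simpa using hgrad ω)
      simpa [Function.comp_def] using hd.tendsto_slope_zero.comp hu'
  have hsum : w = fun ω => ∑ i, inner ℝ (w ω) (stdOrthonormalBasis ℝ E i) •
      stdOrthonormalBasis ℝ E i := by
    funext ω
    conv_lhs => rw [← (stdOrthonormalBasis ℝ E).sum_repr' (w ω)]
    simp only [real_inner_comm]
  rw [hsum]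
  exact Finset.aestronglyMeasurable_fun_sum _ fun i _ => (hinner _).smul_const _

/-- If the expectation of a random convex function is differentiable, with negative minimum
attained at `p`, then the function is measurable at every point. The expectation vanishes
by convention at the non-measurable points, which is incompatible with differentiability at
the first such point on a ray from `p`. -/
theorem aestronglyMeasurable_of_convex_of_integral_neg {f : E → Ω → ℝ} {df : E → Ω → E} {L : ℝ}
    [IsFiniteMeasure P] (hL : 0 ≤ L) (hconv : ∀ ω, ConvexOn ℝ Set.univ (fun y => f y ω))
    (hgrad : ∀ z ω, HasGradientAt (fun y => f y ω) (df z ω) z)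
    (hLip : ∀ ω z y, ‖df z ω - df y ω‖ ≤ L * ‖z - y‖)
    (hdiff : Differentiable ℝ fun y => ∫ ω, f y ω ∂P) {p : E}
    (hneg : ∫ ω, f p ω ∂P < 0) (hint : Integrable (fun ω => ‖df p ω‖) P) (y : E) :
    AEStronglyMeasurable (f y) P := by
  by_contra hy
  have hp : Integrable (f p) P := by
    by_contra h
    rw [integral_undef h] at hneg
    exact hneg.false
  have hintegrable : ∀ z, AEStronglyMeasurable (f z) P → Integrable (f z) P := by
    intro z hz
    have hbound : Integrable (fun ω => (‖df p ω‖ + L * ‖z - p‖) * ‖z - p‖) P :=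
      (hint.add (integrable_const _)).mul_const _
    have hsub : Integrable (fun ω => f z ω - f p ω) P :=
      hbound.mono' (hz.sub hp.1) (Eventually.of_forall fun ω =>
        abs_sub_le_of_lipschitz_gradient hL (fun z => hgrad z ω) (hLip ω) p z)
    exact (hsub.add hp).congr (Eventually.of_forall fun ω => sub_add_cancel _ _)
  set v := y - p with hv
  set φ : ℝ → ℝ := fun s => ∫ ω, f (p + s • v) ω ∂P with hφ
  have hφdiff : Differentiable ℝ φ := hdiff.comp (by fun_prop)
  set S : Set ℝ := {s | 0 ≤ s ∧ ¬ AEStronglyMeasurable (f (p + s • v)) P}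
  have hφS : ∀ s ∈ S, φ s = 0 := fun s hs => integral_undef fun h => hs.2 h.1
  have hSne : S.Nonempty := ⟨1, zero_le_one, by simpa [hv] using hy⟩
  have hSbdd : BddBelow S := ⟨0, fun s hs => hs.1⟩
  set a := sInf S
  have ha0 : 0 ≤ a := le_csInf hSne fun s hs => hs.1
  have hbelow : ∀ s, 0 ≤ s → s < a → AEStronglyMeasurable (f (p + s • v)) P := by
    intro s hs hsa
    by_contra h
    exact (csInf_le hSbdd ⟨hs, h⟩).not_gt hsa
  obtain ⟨u, -, hu, huS⟩ := exists_seq_tendsto_sInf hSne hSbdd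
  have hφa : φ a = 0 := by
    refine tendsto_nhds_unique ((hφdiff.continuous.tendsto a).comp hu) ?_
    simp [Function.comp_def, hφS _ (huS _)]
  have hφ0 : φ 0 < 0 := by simpa [hφ] using hneg
  have hapos : 0 < a := lt_of_le_of_ne ha0 fun h => by rw [← h] at hφa; linarith
  have hameas : AEStronglyMeasurable (f (p + a • v)) P := by
    obtain ⟨r, -, hr, hrlim⟩ := exists_seq_strictMono_tendsto' hapos
    refine aestronglyMeasurable_of_tendsto_ae atTop
      (fun n => hbelow (r n) (hr n).1.le (hr n).2) (Eventually.of_forall fun ω => ?_)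
    have hc : Continuous fun s : ℝ => f (p + s • v) ω :=
      continuous_iff_continuousAt.2 fun s =>
        (HasGradientAt.hasDerivAt_comp_add_smul (g := fun y => f y ω)
          (hgrad (p + s • v) ω)).continuousAt
    exact (hc.tendsto a).comp hrlim
  have hd := (hφdiff a).hasDerivAt
  -- difference quotients vanish along a sequence in `S` decreasing to `a`
  have hderiv0 : deriv φ a = 0 := by
    have hu' : Tendsto u atTop (𝓝[≠] a) :=
      tendsto_nhdsWithin_iff.2 ⟨hu, Eventually.of_forall fun n h => by
        rw [Set.mem_singleton_iff] at h
        exact (h ▸ huS n).2 hameas⟩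
    refine tendsto_nhds_unique ((hasDerivAt_iff_tendsto_slope.1 hd).comp hu') ?_
    simp [Function.comp_def, slope_def_field, hφS _ (huS _), hφa]
  -- convexity on `[0, a]` forces a positive left derivative
  have hchord : ∀ s, 0 ≤ s → s < a → φ s ≤ (1 - s / a) * φ 0 := by
    intro s hs hsa
    have hi0 : Integrable (f (p + (0 : ℝ) • v)) P := by simpa using hp
    have hia := hintegrable _ hameas
    have hle : φ s ≤ ∫ ω, ((1 - s / a) * f (p + (0 : ℝ) • v) ω + s / a * f (p + a • v) ω) ∂P := by
      refine integral_mono (hintegrable _ (hbelow s hs hsa))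
        ((hi0.const_mul _).add (hia.const_mul _)) fun ω => ?_
      have h1 : s / a ≤ 1 := (div_le_one hapos).2 hsa.le
      have h := (hconv ω).2 (Set.mem_univ (p + (0 : ℝ) • v)) (Set.mem_univ (p + a • v))
        (sub_nonneg.2 h1) (div_nonneg hs hapos.le) (by ring)
      have heq : (1 - s / a) • (p + (0 : ℝ) • v) + (s / a) • (p + a • v) = p + s • v := by
        rw [zero_smul, add_zero, smul_add, smul_smul, div_mul_cancel₀ _ hapos.ne', ← add_assoc,
          ← add_smul]
        simp
      simpa only [heq, smul_eq_mul] using h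
    rw [integral_add (hi0.const_mul _) (hia.const_mul _), integral_const_mul,
      integral_const_mul] at hle
    change φ s ≤ (1 - s / a) * φ 0 + s / a * φ a at hle
    simpa [hφa] using hle
  have hderivpos : -φ 0 / a ≤ deriv φ a := by
    have hlim : Tendsto (slope φ a) (𝓝[<] a) (𝓝 (deriv φ a)) :=
      (hasDerivAt_iff_tendsto_slope.1 hd).mono_left
        (nhdsWithin_mono _ fun s hs => ne_of_lt hs)
    refine ge_of_tendsto hlim ?_
    filter_upwards [Ioo_mem_nhdsLT hapos] with s hs
    have hsa : 0 < a - s := sub_pos.2 hs.2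
    rw [slope_comm, slope_def_field, hφa, le_div_iff₀ hsa]
    have h := hchord s hs.1.le hs.2
    have : -φ 0 / a * (a - s) = -((1 - s / a) * φ 0) := by field_simp
    linarith
  have : 0 < -φ 0 / a := div_pos (neg_pos.2 hφ0) hapos
  linarith

end Helpers

/-- Theorem 2.6 for SGD (necessary condition for linear convergence): with `g ≡ 0`, if
`fbar(x) = E_ξ[f(x,ξ)]` satisfies quadratic functional growth with `μ > 0`, each `f(·,ξ)`
is convex with `Lf`-Lipschitz gradient, the SGD iterates
`x (t+1) = x t - γ • ∇f(x t, ξ t)` (constant stepsize `γ > 0`, `x 0` deterministic)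
contract conditionally on the past at rate `q < 1`, and all iterates have the same
projection `x̄ 0` onto the optimal set, then `E_ξ[‖∇f(x̄ 0, ξ)‖²] = 0`, i.e. the
strong stochastic bounded gradient condition (`B = 0`) holds and all partial functions
`f(·,ξ)` have `x̄ 0` as a common minimizer. -/
theorem stmt_9 {m : ℕ} {Ω : Type*} [MeasurableSpace Ω]
    (P : Measure Ω) [IsProbabilityMeasure P]
    (f : EuclideanSpace ℝ (Fin m) → Ω → ℝ)
    (hfconv : ∀ ω, ConvexOn ℝ Set.univ (fun y => f y ω))
    (df : EuclideanSpace ℝ (Fin m) → Ω → EuclideanSpace ℝ (Fin m))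
    (hgrad : ∀ z ω, HasGradientAt (fun y => f y ω) (df z ω) z)
    (Lf : ℝ) (hLf : 0 < Lf)
    (hLip : ∀ ω z y, ‖df z ω - df y ω‖ ≤ Lf * ‖z - y‖)
    (fbar : EuclideanSpace ℝ (Fin m) → ℝ)
    (hfbar : ∀ y, fbar y = ∫ ω, f y ω ∂P)
    -- unbiasedness: `E_ξ[∇f(x,ξ)] = ∇fbar(x)`
    (hunb : ∀ z, HasGradientAt fbar (∫ ω, df z ω ∂P) z)
    (Xstar : Set (EuclideanSpace ℝ (Fin m))) (hXne : Xstar.Nonempty)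
    (hXstar : Xstar = {z | ∀ y, fbar z ≤ fbar y})
    (proj : EuclideanSpace ℝ (Fin m) → EuclideanSpace ℝ (Fin m))
    (hprojmem : ∀ x, proj x ∈ Xstar)
    (hprojdist : ∀ x, ∀ z ∈ Xstar, ‖x - proj x‖ ≤ ‖x - z‖)
    -- quadratic functional growth (Assumption 2) with `μ > 0`
    (μ : ℝ) (hμ : 0 < μ)
    (hgrowth : ∀ z, μ / 2 * ‖z - proj z‖ ^ 2 ≤ fbar z - fbar (proj z))
    -- SGD iterates with constant stepsize, viewed pathwise over realizations `ω : ℕ → Ω`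
    (γ : ℝ) (hγ : 0 < γ)
    (x : ℕ → (ℕ → Ω) → EuclideanSpace ℝ (Fin m))
    (x0 : EuclideanSpace ℝ (Fin m)) (hx0 : ∀ ω, x 0 ω = x0)
    (hiter : ∀ t ω, x (t + 1) ω = x t ω - γ • df (x t ω) (ω t))
    -- conditional linear contraction: `E_{ξ t}[‖x (t+1) - x̄ (t+1)‖² | ξ_{[t-1]}] ≤ q ‖x t - x̄ t‖²`
    (q : ℝ) (hq : q < 1)
    (hcontr : ∀ t (ω : ℕ → Ω),
      ∫ ξ, ‖(x t ω - γ • df (x t ω) ξ) - proj (x t ω - γ • df (x t ω) ξ)‖ ^ 2 ∂P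
        ≤ q * ‖x t ω - proj (x t ω)‖ ^ 2)
    -- the iterates have a.s. the same projection onto the optimal set
    (hsameproj : ∀ t (ω : ℕ → Ω), proj (x t ω) = proj x0) :
    ∫ ω, ‖df (proj x0) ω‖ ^ 2 ∂P = 0 := by
  by_cases hsq : Integrable (fun ω => ‖df (proj x0) ω‖ ^ 2) P
  swap
  · exact integral_undef hsq
  set p := proj x0
  have hnorm : Integrable (fun ω => ‖df p ω‖) P := by
    have hmeas : AEStronglyMeasurable (fun ω => ‖df p ω‖) P := by
      simpa [Real.sqrt_sq] using Real.continuous_sqrt.comp_aestronglyMeasurable hsq.1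
    exact ((memLp_two_iff_integrable_sq hmeas).2 hsq).integrable one_le_two
  have hfdiff : Differentiable ℝ fbar := fun z => (hunb z).differentiableAt
  have hfbar' : fbar = fun y => ∫ ω, f y ω ∂P := funext hfbar
  have hmeas : ∀ z, proj z = p → z ≠ p → AEStronglyMeasurable (df z) P := by
    intro z hz hzp
    refine aestronglyMeasurable_gradient (hgrad z) ?_
    by_cases h0 : fbar z = 0
    · have hlt : fbar p < 0 := by
        have hg := hgrowth z
        have : 0 < ‖z - p‖ := norm_pos_iff.2 (sub_ne_zero.2 hzp)
        rw [hz, h0] at hg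
        have : 0 < μ / 2 * ‖z - p‖ ^ 2 := by positivity
        linarith
      exact Eventually.of_forall (aestronglyMeasurable_of_convex_of_integral_neg hLf.le hfconv
        hgrad hLip (hfbar' ▸ hfdiff) (hfbar p ▸ hlt) hnorm)
    · filter_upwards [hfdiff.continuous.continuousAt.eventually_ne h0] with y hy
      by_contra h
      exact hy (by rw [hfbar, integral_undef fun hi => h hi.1])
  have hint : ∀ z, proj z = p → Integrable (fun ξ => ‖z - γ • df z ξ - p‖ ^ 2) P := by
    intro z hz
    rcases eq_or_ne z p with rfl | hzp
    · simpa [sub_right_comm, norm_smul, mul_pow] using hsq.const_mul (γ ^ 2)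
    have hm := hmeas z hz hzp
    have hbound : Integrable (fun ξ => 2 * ((1 + γ * Lf) * ‖z - p‖) ^ 2
        + 2 * (γ ^ 2 * ‖df p ξ‖ ^ 2)) P :=
      (integrable_const _).add ((hsq.const_mul _).const_mul _)
    refine hbound.mono' ?_ (Eventually.of_forall fun ξ => ?_)
    · exact (((aestronglyMeasurable_const.sub (hm.const_smul γ)).sub
        aestronglyMeasurable_const).norm.pow 2)
    · rw [Real.norm_of_nonneg (by positivity)]
      have heq : z - γ • df z ξ - p = (z - p) - γ • (df z ξ - df p ξ) - γ • df p ξ := by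
        rw [smul_sub]; abel
      have h1 : ‖z - γ • df z ξ - p‖ ≤ (1 + γ * Lf) * ‖z - p‖ + γ * ‖df p ξ‖ := by
        have h2 : ‖z - γ • df z ξ - p‖ ≤
            ‖z - p‖ + ‖γ • (df z ξ - df p ξ)‖ + ‖γ • df p ξ‖ := by
          rw [heq]
          exact (norm_sub_le _ _).trans (by gcongr; exact norm_sub_le _ _)
        rw [norm_smul, norm_smul, Real.norm_of_nonneg hγ.le] at h2
        nlinarith [mul_le_mul_of_nonneg_left (hLip ξ z p) hγ.le]
      have h3 := pow_le_pow_left₀ (norm_nonneg _) h1 2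
      nlinarith [sq_nonneg ((1 + γ * Lf) * ‖z - p‖ - γ * ‖df p ξ‖)]
  have hcontr' : ∀ t ω, ∫ ξ, ‖x t ω - γ • df (x t ω) ξ - p‖ ^ 2 ∂P ≤ q * ‖x t ω - p‖ ^ 2 := by
    intro t ω
    have h := hcontr t ω
    have hstep : ∀ ξ, proj (x t ω - γ • df (x t ω) ξ) = p := fun ξ => by
      obtain ⟨ω', hω'⟩ := exists_iterate_eq_step (step := fun z ξ => z - γ • df z ξ) hx0 hiter t ω ξ
      exact hω' ▸ hsameproj (t + 1) ω'
    simpa only [hstep, hsameproj] using h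
  set r := max q 0
  have hr1 : r < 1 := max_lt hq one_pos
  have hr0 : 0 ≤ r := le_max_right _ _
  have hclose : ∀ t, ∃ ω, ‖x t ω - p‖ ^ 2 ≤ r ^ t * ‖x0 - p‖ ^ 2 := by
    intro t
    induction t with
    | zero =>
      obtain ⟨ξ⟩ := nonempty_of_isProbabilityMeasure P
      exact ⟨fun _ => ξ, by simp [hx0]⟩
    | succ t ih =>
      obtain ⟨ω, hω⟩ := ih
      obtain ⟨ξ, hξ⟩ := exists_le_integral (hint _ (hsameproj t ω))
      obtain ⟨ω', hω'⟩ := exists_iterate_eq_step (step := fun z ξ => z - γ • df z ξ) hx0 hiter t ω ξ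
      refine ⟨ω', ?_⟩
      rw [hω', pow_succ' r, mul_assoc]
      calc _ ≤ q * ‖x t ω - p‖ ^ 2 := hξ.trans (hcontr' t ω)
        _ ≤ r * ‖x t ω - p‖ ^ 2 := by gcongr; exact le_max_left _ _
        _ ≤ _ := by gcongr
  set C := 2 * (r + (1 + γ * Lf) ^ 2)
  have hCnonneg : 0 ≤ C := by positivity
  have hmoment : ∀ t, γ ^ 2 * ∫ ω, ‖df p ω‖ ^ 2 ∂P ≤ C * (r ^ t * ‖x0 - p‖ ^ 2) := by
    intro t
    obtain ⟨ω, hω⟩ := hclose t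
    have hcr : q * ‖x t ω - p‖ ^ 2 ≤ r * ‖x t ω - p‖ ^ 2 := by gcongr; exact le_max_left _ _
    exact (integral_sq_norm_le_of_contraction hγ (fun ξ => hLip ξ _ _) hsq
      (hint _ (hsameproj t ω)) ((hcontr' t ω).trans hcr)).trans
      (mul_le_mul_of_nonneg_left hω hCnonneg)
  have hlim : Tendsto (fun t : ℕ => C * (r ^ t * ‖x0 - p‖ ^ 2)) atTop (𝓝 0) := by
    simpa using ((tendsto_pow_atTop_nhds_zero_of_lt_one hr0 hr1).mul_const
      (‖x0 - p‖ ^ 2)).const_mul C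
  have hle : γ ^ 2 * ∫ ω, ‖df p ω‖ ^ 2 ∂P ≤ 0 := ge_of_tendsto' hlim hmoment
  exact le_antisymm (nonpos_of_mul_nonpos_right hle (by positivity))
    (integral_nonneg fun ω => by positivity)
end

section
/- If there exist constants c ∈ (0,1), d > 0, a finite index t_0 ≥ 0, and a nonnegative real sequence (r_t) with r_{t_0} finite satisfying r_{t+1} ≤ (1 − c/(t+1)) r_t + d/(t+1)² for all t ≥ t_0, then for all t ≥ t_0 it holds that r_t ≤ ( r_{t_0} (t_0+1)^c + 2d(2 − c)(t_0+1)^c/(1 − c) ) · 1/(t+1)^c. -/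
/-- Bernoulli's inequality in the form used to compare consecutive powers. -/
theorem add_one_rpow_mul_le {c x : ℝ} (hc0 : 0 ≤ c) (hc1 : c ≤ 1) (hx : 0 < x) :
    (x + 1) ^ c * x ≤ x ^ c * (x + c) := by
  have h : (1 + 1 / x) ^ c ≤ 1 + c * (1 / x) :=
    rpow_one_add_le_one_add_mul_self (by have := one_div_pos.2 hx; linarith) hc0 hc1
  have e : x + 1 = x * (1 + 1 / x) := by field_simp
  rw [e, Real.mul_rpow hx.le (by positivity)]
  calc x ^ c * (1 + 1 / x) ^ c * x ≤ x ^ c * (1 + c * (1 / x)) * x := by gcongr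
    _ = x ^ c * (x + c) := by field_simp

/-- A potential whose decrements dominate `(x + 1) ^ c / x ^ 2`. -/
noncomputable def rpowPotential (c x : ℝ) : ℝ :=
  2 * x ^ c * (1 / x ^ 2 + 1 / (x * (1 - c)))

theorem rpowPotential_nonneg {c x : ℝ} (hc1 : c < 1) (hx : 0 < x) : 0 ≤ rpowPotential c x := by
  have : 0 < 1 - c := sub_pos.2 hc1
  unfold rpowPotential
  positivity

theorem rpowPotential_le {c x : ℝ} (hc1 : c < 1) (hx : 1 ≤ x) :
    rpowPotential c x ≤ 2 * (2 - c) * x ^ c / (1 - c) := by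
  have h1c : 0 < 1 - c := sub_pos.2 hc1
  have hx0 : 0 < x := by linarith
  have h1 : 1 / x ^ 2 ≤ 1 := by
    rw [div_le_one (by positivity)]
    exact one_le_pow₀ hx
  have h2 : 1 / (x * (1 - c)) ≤ 1 / (1 - c) :=
    one_div_le_one_div_of_le h1c (le_mul_of_one_le_left h1c.le hx)
  calc rpowPotential c x ≤ 2 * x ^ c * (1 + 1 / (1 - c)) := by
        unfold rpowPotential
        gcongr
    _ = 2 * (2 - c) * x ^ c / (1 - c) := by
        field_simp
        ring

theorem add_one_rpow_div_sq_le_rpowPotential_sub {c x : ℝ} (hc0 : 0 ≤ c) (hc1 : c < 1)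
    (hx : 1 ≤ x) :
    (x + 1) ^ c / x ^ 2 ≤ rpowPotential c x - rpowPotential c (x + 1) := by
  have h1c : 0 < 1 - c := sub_pos.2 hc1
  have hx0 : 0 < x := by linarith
  have hb := add_one_rpow_mul_le hc0 hc1.le hx0
  unfold rpowPotential
  have hN : 0 < x ^ c := by positivity
  have hM : 0 < (x + 1) ^ c := by positivity
  generalize x ^ c = N at *
  generalize (x + 1) ^ c = M at *
  have hMN : M ≤ 2 * N := by
    refine le_of_mul_le_mul_right (hb.trans ?_) hx0
    nlinarith
  have h1 : M / x ^ 2 ≤ 2 * N / x ^ 2 := by gcongr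
  have h2 : M / (x + c) ≤ N / x := by
    rw [div_le_div_iff₀ (by linarith) hx0]
    exact hb
  have h3 : M / (x + 1) + (1 - c) * (M / (x + 1) ^ 2) ≤ M / (x + c) := by
    have e : M / (x + c) = M / (x + 1) + (1 - c) * (M / ((x + c) * (x + 1))) := by
      have : x + c ≠ 0 := by positivity
      field_simp
      ring
    rw [e, sq]
    gcongr
  have h4 : M / (x + 1) ^ 2 ≤ (N / x - M / (x + 1)) / (1 - c) := by
    rw [le_div_iff₀ h1c]
    linarith
  have e : 2 * N * (1 / x ^ 2 + 1 / (x * (1 - c)))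
        - 2 * M * (1 / (x + 1) ^ 2 + 1 / ((x + 1) * (1 - c)))
      = 2 * N / x ^ 2 + 2 * ((N / x - M / (x + 1)) / (1 - c) - M / (x + 1) ^ 2) := by
    field_simp
    ring
  linarith

theorem one_sub_div_mul_add_one_rpow_le {c x : ℝ} (hc0 : 0 ≤ c) (hc1 : c ≤ 1) (hx : 1 ≤ x) :
    (1 - c / x) * (x + 1) ^ c ≤ x ^ c := by
  have hx0 : 0 < x := by linarith
  have hb := add_one_rpow_mul_le hc0 hc1 hx0
  have hN : 0 < x ^ c := by positivity
  have e : (1 - c / x) * (x + 1) ^ c = (x - c) * ((x + 1) ^ c * x) / x ^ 2 := by field_simp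
  rw [e, div_le_iff₀ (by positivity)]
  have := mul_le_mul_of_nonneg_left hb (show 0 ≤ x - c by linarith)
  nlinarith [mul_nonneg hN.le (sq_nonneg c)]

/-- Lemma 1.1 (case c < 1), Polyak-type recurrence: if `c ∈ (0,1)` and the nonnegative
sequence `r` satisfies `r (t+1) ≤ (1 - c/(t+1)) r t + d/(t+1)^2` for all `t ≥ t0`, then
`r t ≤ (r t0 (t0+1)^c + 2 d (2-c) (t0+1)^c / (1-c)) / (t+1)^c` for all `t ≥ t0`. -/
theorem stmt_14 (c d : ℝ) (hc0 : 0 < c) (hc1 : c < 1) (hd : 0 < d) (t0 : ℕ)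
    (r : ℕ → ℝ) (hr : ∀ t, 0 ≤ r t)
    (hrec : ∀ t : ℕ, t0 ≤ t →
      r (t + 1) ≤ (1 - c / ((t : ℝ) + 1)) * r t + d / ((t : ℝ) + 1) ^ 2) :
    ∀ t : ℕ, t0 ≤ t →
      r t ≤ (r t0 * ((t0 : ℝ) + 1) ^ c
              + 2 * d * (2 - c) * ((t0 : ℝ) + 1) ^ c / (1 - c)) * (1 / ((t : ℝ) + 1) ^ c) := by
  intro t ht
  have key : r t * ((t : ℝ) + 1) ^ c ≤ r t0 * ((t0 : ℝ) + 1) ^ c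
      + d * (rpowPotential c ((t0 : ℝ) + 1) - rpowPotential c ((t : ℝ) + 1)) := by
    induction t, ht using Nat.le_induction with
    | base => simp
    | succ t ht ih =>
      push_cast
      have hx : (1 : ℝ) ≤ (t : ℝ) + 1 := by simp
      have hrt := hrec t ht
      generalize (t : ℝ) + 1 = x at *
      have hx0 : 0 < x := by linarith
      have h1 := mul_le_mul_of_nonneg_right hrt (show 0 ≤ (x + 1) ^ c by positivity)
      have h2 := mul_le_mul_of_nonneg_left
        (one_sub_div_mul_add_one_rpow_le hc0.le hc1.le hx) (hr t)
      have h3 := mul_le_mul_of_nonneg_left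
        (add_one_rpow_div_sq_le_rpowPotential_sub hc0.le hc1 hx) hd.le
      have e : ((1 - c / x) * r t + d / x ^ 2) * (x + 1) ^ c
          = r t * ((1 - c / x) * (x + 1) ^ c) + d * ((x + 1) ^ c / x ^ 2) := by ring
      linarith
  rw [mul_one_div, le_div_iff₀ (by positivity)]
  have h1 := rpowPotential_nonneg (c := c) hc1 (show 0 < (t : ℝ) + 1 by positivity)
  have h2 := rpowPotential_le (c := c) hc1 (show 1 ≤ (t0 : ℝ) + 1 by simp)
  have h3 : d * (rpowPotential c ((t0 : ℝ) + 1) - rpowPotential c ((t : ℝ) + 1))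
      ≤ d * (2 * (2 - c) * ((t0 : ℝ) + 1) ^ c / (1 - c)) :=
    mul_le_mul_of_nonneg_left (by linarith) hd.le
  have e : d * (2 * (2 - c) * ((t0 : ℝ) + 1) ^ c / (1 - c))
      = 2 * d * (2 - c) * ((t0 : ℝ) + 1) ^ c / (1 - c) := by ring
  linarith
end

section
/- If there exist constants c, d > 0, exponents γ ∈ (0,1) and ζ > γ, a finite index t_0 ≥ 0, and a nonnegative real sequence (r_t) with r_{t_0} finite satisfying r_{t+1} ≤ (1 − c/(t+1)^γ) r_t + d/(t+1)^ζ for all t ≥ t_0, then r_t decays at the sublinear rate O(1/t^{ζ−γ}); that is, there exists a constant C > 0 (depending on c, d, γ, ζ, t_0 and r_{t_0}) such that r_t ≤ C / t^{ζ−γ} for all t > t_0. -/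
/-- For `γ < 1`, the ratio `((t + 1) / t) ^ p` is eventually at most `1 + b / (t + 1) ^ γ`. -/
theorem eventually_add_one_rpow_le {b γ p : ℝ} (hb : 0 < b) (hγ1 : γ < 1) (hp : 0 < p) :
    ∀ᶠ t : ℕ in Filter.atTop,
      ((t : ℝ) + 1) ^ p ≤ (1 + b / ((t : ℝ) + 1) ^ γ) * (t : ℝ) ^ p := by
  have hε : 0 < b / (4 * p) := by positivity
  have hn : Filter.Tendsto (fun t : ℕ => (t : ℝ) + 1) Filter.atTop Filter.atTop :=
    Filter.tendsto_atTop_add_const_right _ _ tendsto_natCast_atTop_atTop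
  have hlo := ((tendsto_rpow_atTop (sub_pos.2 hγ1)).comp hn).eventually_ge_atTop (4 * p / b)
  filter_upwards [hlo, Filter.eventually_ge_atTop 1,
    tendsto_natCast_atTop_atTop.eventually_ge_atTop p] with t ht ht1 htp
  have ht1' : (1 : ℝ) ≤ t := by exact_mod_cast ht1
  have ht0 : (0 : ℝ) < t := by linarith
  have hn0 : (0 : ℝ) < (t : ℝ) + 1 := by linarith
  have hnγ : 0 < ((t : ℝ) + 1) ^ γ := Real.rpow_pos_of_pos hn0 γ
  have hnγ_le : ((t : ℝ) + 1) ^ γ ≤ b / (4 * p) * ((t : ℝ) + 1) := by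
    calc ((t : ℝ) + 1) ^ γ = b / (4 * p) * (((t : ℝ) + 1) ^ γ * (4 * p / b)) := by field_simp
      _ ≤ b / (4 * p) * (((t : ℝ) + 1) ^ γ * ((t : ℝ) + 1) ^ (1 - γ)) := by gcongr; exact ht
      _ = b / (4 * p) * ((t : ℝ) + 1) := by
        rw [← Real.rpow_add hn0, add_sub_cancel, Real.rpow_one]
  have hratio : (((t : ℝ) + 1) / t) ^ p ≤ Real.exp (p / t) := by
    have h1 : ((t : ℝ) + 1) / t ≤ Real.exp (1 / t) := by
      have := Real.add_one_le_exp (1 / (t : ℝ))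
      rwa [add_div, div_self ht0.ne', add_comm]
    calc (((t : ℝ) + 1) / t) ^ p ≤ Real.exp (1 / t) ^ p :=
          Real.rpow_le_rpow (by positivity) h1 hp.le
      _ = Real.exp (p / t) := by rw [← Real.exp_mul]; congr 1; ring
  have hexp : Real.exp (p / t) ≤ 1 + 2 * (p / t) := by
    have hpt : |p / (t : ℝ)| = p / t := abs_of_pos (by positivity)
    have := Real.abs_exp_sub_one_le (x := p / t) (by rw [hpt]; exact (div_le_one ht0).2 htp)
    rw [hpt] at this
    linarith [le_abs_self (Real.exp (p / t) - 1)]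
  have hlin : 2 * (p / t) ≤ b / ((t : ℝ) + 1) ^ γ := by
    have h1 : ((t : ℝ) + 1) ^ γ ≤ b / (4 * p) * (2 * t) :=
      hnγ_le.trans (mul_le_mul_of_nonneg_left (by linarith) hε.le)
    rw [le_div_iff₀ hnγ]
    calc 2 * (p / t) * ((t : ℝ) + 1) ^ γ ≤ 2 * (p / t) * (b / (4 * p) * (2 * t)) := by gcongr
      _ = b := by field_simp; norm_num
  rw [← div_le_iff₀ (Real.rpow_pos_of_pos ht0 p), ← Real.div_rpow hn0.le ht0.le]
  linarith


/-- Lemma 1.2, Polyak-type recurrence with exponents: if `0 < γ < 1`, `ζ > γ`, `c, d > 0`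
and the nonnegative sequence `r` satisfies
`r (t+1) ≤ (1 - c/(t+1)^γ) r t + d/(t+1)^ζ` for all `t ≥ t0`, then `r t = O(1/t^(ζ-γ))`:
there exists `C > 0` such that `r t ≤ C / t^(ζ-γ)` for all `t > t0`. -/
theorem stmt_16 (c d γ ζ : ℝ) (hc : 0 < c) (hd : 0 < d)
    (hγ0 : 0 < γ) (hγ1 : γ < 1) (hζ : γ < ζ) (t0 : ℕ)
    (r : ℕ → ℝ) (hr : ∀ t, 0 ≤ r t)
    (hrec : ∀ t : ℕ, t0 ≤ t →
      r (t + 1) ≤ (1 - c / ((t : ℝ) + 1) ^ γ) * r t + d / ((t : ℝ) + 1) ^ ζ) :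
    ∃ C : ℝ, 0 < C ∧ ∀ t : ℕ, t0 < t → r t ≤ C / (t : ℝ) ^ (ζ - γ) := by
  have hp : 0 < ζ - γ := sub_pos.2 hζ
  have hn : Filter.Tendsto (fun t : ℕ => (t : ℝ) + 1) Filter.atTop Filter.atTop :=
    Filter.tendsto_atTop_add_const_right _ _ tendsto_natCast_atTop_atTop
  obtain ⟨N, hN⟩ := Filter.eventually_atTop.1
    ((eventually_add_one_rpow_le (half_pos hc) hγ1 hp).and
      (((tendsto_rpow_atTop hγ0).comp hn).eventually_ge_atTop c))
  set T := max N (t0 + 1)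
  set S := ∑ t ∈ Finset.range (T + 1), r t * (t : ℝ) ^ (ζ - γ)
  have hterm : ∀ t : ℕ, 0 ≤ r t * (t : ℝ) ^ (ζ - γ) := fun t => mul_nonneg (hr t) (by positivity)
  have hS : 0 ≤ S := Finset.sum_nonneg fun t _ => hterm t
  have hdc : 0 < 2 * d / c := by positivity
  have hinit : ∀ t ≤ T, r t * (t : ℝ) ^ (ζ - γ) ≤ S + 2 * d / c := fun t ht => by
    have := Finset.single_le_sum (f := fun t : ℕ => r t * (t : ℝ) ^ (ζ - γ))
      (fun t _ => hterm t) (Finset.mem_range.2 (Nat.lt_succ_of_le ht))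
    exact this.trans (le_add_of_nonneg_right hdc.le)
  have hmain : ∀ t ≥ T, r t * (t : ℝ) ^ (ζ - γ) ≤ S + 2 * d / c := by
    intro t ht
    induction t, ht using Nat.le_induction with
    | base => exact hinit T le_rfl
    | succ t ht ih =>
      obtain ⟨hpow, hγc⟩ := hN t ((le_max_left _ _).trans ht)
      have hstep := hrec t (by have := le_max_right N (t0 + 1); omega)
      simp only [Function.comp_apply] at hγc
      have hn0 : (0 : ℝ) < (t : ℝ) + 1 := by positivity
      have hnγ := Real.rpow_pos_of_pos hn0 γ
      have hnp := Real.rpow_pos_of_pos hn0 (ζ - γ)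
      have hsplit : ((t : ℝ) + 1) ^ ζ = ((t : ℝ) + 1) ^ γ * ((t : ℝ) + 1) ^ (ζ - γ) := by
        rw [← Real.rpow_add hn0]; congr 1; ring
      have hx1 : c / ((t : ℝ) + 1) ^ γ ≤ 1 := (div_le_one hnγ).2 hγc
      have hx0 : 0 < c / ((t : ℝ) + 1) ^ γ := by positivity
      have hhalf : c / 2 / ((t : ℝ) + 1) ^ γ = c / ((t : ℝ) + 1) ^ γ / 2 := by ring
      have hdx : d / ((t : ℝ) + 1) ^ ζ * ((t : ℝ) + 1) ^ (ζ - γ) =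
          c / ((t : ℝ) + 1) ^ γ / 2 * (2 * d / c) := by
        rw [hsplit]; field_simp
      rw [hhalf] at hpow
      push_cast
      set x := c / ((t : ℝ) + 1) ^ γ
      have hC : 0 ≤ S + 2 * d / c := by positivity
      calc r (t + 1) * ((t : ℝ) + 1) ^ (ζ - γ)
          ≤ ((1 - x) * r t + d / ((t : ℝ) + 1) ^ ζ) * ((t : ℝ) + 1) ^ (ζ - γ) := by gcongr
        _ = (1 - x) * (r t * ((t : ℝ) + 1) ^ (ζ - γ)) + x / 2 * (2 * d / c) := by
          rw [← hdx]; ring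
        _ ≤ (1 - x) * (r t * ((1 + x / 2) * (t : ℝ) ^ (ζ - γ))) + x / 2 * (2 * d / c) := by
          have := hr t
          have : 0 ≤ 1 - x := sub_nonneg.2 hx1
          gcongr
        _ = (1 - x) * (1 + x / 2) * (r t * (t : ℝ) ^ (ζ - γ)) + x / 2 * (2 * d / c) := by ring
        _ ≤ (1 - x) * (1 + x / 2) * (S + 2 * d / c) + x / 2 * (S + 2 * d / c) := by
          have : 0 ≤ 1 - x := sub_nonneg.2 hx1
          gcongr
          linarith
        _ = (S + 2 * d / c) - x ^ 2 / 2 * (S + 2 * d / c) := by ring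
        _ ≤ S + 2 * d / c := sub_le_self _ (by positivity)
  refine ⟨S + 2 * d / c, by positivity, fun t ht => ?_⟩
  have ht0 : (0 : ℝ) < t := by exact_mod_cast Nat.zero_lt_of_lt ht
  rw [le_div_iff₀ (Real.rpow_pos_of_pos ht0 _)]
  exact (le_total t T).elim (hinit t) (hmain t)
end

section
/- Smooth plus bounded-subgradient regularizer implies the stochastic bounded gradient condition: assume each f(·,ξ) is convex with L(ξ)-Lipschitz continuous gradient and L(ξ) ≤ L_f for all ξ ∈ Ω, each g(·,ξ) is convex with uniformly bounded subgradients ‖∇g(x,ξ)‖ ≤ B_g for all x ∈ dom F and ξ, and the stochastic (sub)gradients are unbiased. Then the stochastic bounded gradient condition holds with constants L = 4L_f and B² = 4(B_g² + min_{x̄ ∈ X*} E_ξ[‖∇f(x̄,ξ)‖²]); in particular, E_ξ[‖∇f(x,ξ) + ∇g(x,ξ)‖²] ≤ 4L_f(F(x) − F*) + 4(B_g² + E_ξ[‖∇f(x̄,ξ)‖²]) for all x ∈ dom F and any minimizer x̄ ∈ X*. -/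
open MeasureTheory
open scoped RealInnerProductSpace

theorem sq_norm_add_add_le {E : Type*} [NormedAddCommGroup E] [InnerProductSpace ℝ E]
    (a b c : E) :
    ‖a + b + c‖ ^ 2 ≤ 2 * ‖a‖ ^ 2 + 4 * ‖b‖ ^ 2 + 4 * ‖c‖ ^ 2 := by
  have h1 := parallelogram_law_with_norm ℝ a (b + c)
  have h2 := parallelogram_law_with_norm ℝ b c
  rw [← add_assoc] at h1
  nlinarith [sq_nonneg ‖a - (b + c)‖, sq_nonneg ‖b - c‖]

section SmoothConvex

variable {E : Type*} [NormedAddCommGroup E] [InnerProductSpace ℝ E] [CompleteSpace E]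

theorem HasGradientAt.hasDerivAt_comp_line {φ : E → ℝ} {z v u : E} {t : ℝ}
    (h : HasGradientAt φ u (z + t • v)) :
    HasDerivAt (fun s : ℝ => φ (z + s • v)) ⟪u, v⟫ t := by
  have hl : HasDerivAt (fun s : ℝ => z + s • v) v t := by
    simpa using ((hasDerivAt_id t).smul_const v).const_add z
  simpa [Function.comp_def] using h.hasFDerivAt.comp_hasDerivAt t hl

theorem ConvexOn.add_inner_le_of_hasGradientAt {φ : E → ℝ} (hφ : ConvexOn ℝ Set.univ φ)
    {z u : E} (h : HasGradientAt φ u z) (y : E) : φ z + ⟪u, y - z⟫ ≤ φ y := by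
  have hd : HasDerivAt (fun s : ℝ => φ (z + s • (y - z))) ⟪u, y - z⟫ 0 :=
    HasGradientAt.hasDerivAt_comp_line (by simpa using h)
  have hc : ConvexOn ℝ Set.univ (fun s : ℝ => φ (z + s • (y - z))) := by
    have := hφ.comp_affineMap (AffineMap.lineMap z y : ℝ →ᵃ[ℝ] E)
    simpa [Function.comp_def, AffineMap.lineMap_apply, add_comm] using this
  have := hc.le_slope_of_hasDerivAt (Set.mem_univ 0) (Set.mem_univ 1) one_pos hd
  simp [slope_def_field] at this
  linarith

/-- The descent lemma for functions with Lipschitz gradient. -/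
theorem le_add_inner_add_sq_of_lipschitz_gradient {φ : E → ℝ} {dφ : E → E} {L : ℝ}
    (hgrad : ∀ z, HasGradientAt φ (dφ z) z)
    (hLip : ∀ z y, ‖dφ z - dφ y‖ ≤ L * ‖z - y‖) (x v : E) :
    φ (x + v) ≤ φ x + ⟪dφ x, v⟫ + L / 2 * ‖v‖ ^ 2 := by
  have hd (t : ℝ) : HasDerivAt
      (fun s : ℝ => φ (x + s • v) - s * ⟪dφ x, v⟫ - s ^ 2 * (L / 2 * ‖v‖ ^ 2))
      (⟪dφ (x + t • v), v⟫ - ⟪dφ x, v⟫ - t * (L * ‖v‖ ^ 2)) t := by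
    have h1 := (hgrad (x + t • v)).hasDerivAt_comp_line
    have h2 := (hasDerivAt_id t).mul_const ⟪dφ x, v⟫
    have h3 := (hasDerivAt_pow 2 t).mul_const (L / 2 * ‖v‖ ^ 2)
    refine ((h1.sub h2).sub h3).congr_deriv ?_
    norm_num
    ring
  have hanti := antitoneOn_of_deriv_nonpos (convex_Icc (0 : ℝ) 1)
    (fun t _ => (hd t).continuousAt.continuousWithinAt)
    (fun t _ => (hd t).differentiableAt.differentiableWithinAt)
    (fun t ht => by
      rw [interior_Icc] at ht
      rw [(hd t).deriv, ← inner_sub_left]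
      have h1 := real_inner_le_norm (dφ (x + t • v) - dφ x) v
      have h2 := hLip (x + t • v) x
      rw [add_sub_cancel_left, norm_smul, Real.norm_of_nonneg ht.1.le] at h2
      nlinarith [norm_nonneg v])
  have := hanti (Set.left_mem_Icc.2 zero_le_one) (Set.right_mem_Icc.2 zero_le_one) zero_le_one
  simp at this
  linarith

/-- For a convex function with `L`-Lipschitz gradient, the squared gradient distance is controlled
by the Bregman divergence. -/
theorem ConvexOn.sq_norm_gradient_sub_le {φ : E → ℝ} {dφ : E → E} {L : ℝ} (hL : 0 < L)
    (hφ : ConvexOn ℝ Set.univ φ) (hgrad : ∀ z, HasGradientAt φ (dφ z) z)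
    (hLip : ∀ z y, ‖dφ z - dφ y‖ ≤ L * ‖z - y‖) (x y : E) :
    ‖dφ x - dφ y‖ ^ 2 ≤ 2 * L * (φ x - φ y - ⟪dφ y, x - y⟫) := by
  set d := dφ x - dφ y with hd
  have h1 := le_add_inner_add_sq_of_lipschitz_gradient hgrad hLip x (-(L⁻¹ • d))
  have h2 := hφ.add_inner_le_of_hasGradientAt (hgrad y) (x + -(L⁻¹ • d))
  have h3 : ⟪dφ x, d⟫ - ⟪dφ y, d⟫ = ‖d‖ ^ 2 := by
    rw [← inner_sub_left, ← hd, real_inner_self_eq_norm_sq]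
  have h4 : x + -(L⁻¹ • d) - y = (x - y) + -(L⁻¹ • d) := by abel
  rw [h4, inner_add_right, inner_neg_right, real_inner_smul_right] at h2
  rw [inner_neg_right, real_inner_smul_right, norm_neg, norm_smul,
    Real.norm_of_nonneg (inv_nonneg.2 hL.le)] at h1
  have h5 : L⁻¹ * ‖d‖ ^ 2 - L / 2 * (L⁻¹ * ‖d‖) ^ 2 ≤ φ x - φ y - ⟪dφ y, x - y⟫ := by
    have h6 : L⁻¹ * ‖d‖ ^ 2 = L⁻¹ * ⟪dφ x, d⟫ - L⁻¹ * ⟪dφ y, d⟫ := by rw [← h3, mul_sub]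
    linarith
  have h6 : ‖d‖ ^ 2 = 2 * L * (L⁻¹ * ‖d‖ ^ 2 - L / 2 * (L⁻¹ * ‖d‖) ^ 2) := by
    field_simp
    ring
  rw [h6]
  gcongr

end SmoothConvex

/-- Example 2 (smooth plus bounded-subgradient regularizer implies the stochastic bounded
gradient condition): if each `f(·,ξ)` is convex with `L(ξ)`-Lipschitz gradient,
`L(ξ) ≤ Lf`, each `g(·,ξ)` is convex with subgradients uniformly bounded by `Bg`, and
the stochastic (sub)gradients are unbiased, then for every `x` and every minimizer
`x̄ ∈ X*`:
`E_ξ[‖∇f(x,ξ) + ∇g(x,ξ)‖²] ≤ 4 Lf (F(x) - F*) + 4 (Bg² + E_ξ[‖∇f(x̄,ξ)‖²])`,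
i.e. the stochastic bounded gradient condition holds with `L = 4 Lf` and
`B² = 4 (Bg² + min_{x̄ ∈ X*} E_ξ[‖∇f(x̄,ξ)‖²])`. -/
theorem stmt_18 {m : ℕ} {Ω : Type*} [MeasurableSpace Ω]
    (P : Measure Ω) [IsProbabilityMeasure P]
    (f g : EuclideanSpace ℝ (Fin m) → Ω → ℝ)
    (hfconv : ∀ ω, ConvexOn ℝ Set.univ (fun y => f y ω))
    (hgconv : ∀ ω, ConvexOn ℝ Set.univ (fun y => g y ω))
    (df : EuclideanSpace ℝ (Fin m) → Ω → EuclideanSpace ℝ (Fin m))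
    (hgrad : ∀ z ω, HasGradientAt (fun y => f y ω) (df z ω) z)
    (Lxi : Ω → ℝ) (Lf : ℝ) (hLf : 0 < Lf) (hLxi : ∀ ω, Lxi ω ≤ Lf)
    (hLip : ∀ ω z y, ‖df z ω - df y ω‖ ≤ Lxi ω * ‖z - y‖)
    (dg : EuclideanSpace ℝ (Fin m) → Ω → EuclideanSpace ℝ (Fin m))
    (hdg : ∀ z ω y, g z ω + ⟪dg z ω, y - z⟫ ≤ g y ω)
    (Bg : ℝ) (hBg : 0 ≤ Bg) (hgbdd : ∀ z ω, ‖dg z ω‖ ≤ Bg)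
    -- unbiasedness of the stochastic (sub)gradients
    (hunbf : ∀ z y, (∫ ω, f z ω ∂P) + ⟪∫ ω, df z ω ∂P, y - z⟫ ≤ ∫ ω, f y ω ∂P)
    (hunbg : ∀ z y, (∫ ω, g z ω ∂P) + ⟪∫ ω, dg z ω ∂P, y - z⟫ ≤ ∫ ω, g y ω ∂P)
    (F : EuclideanSpace ℝ (Fin m) → ℝ)
    (hF : ∀ y, F y = ∫ ω, (f y ω + g y ω) ∂P)
    (Fstar : ℝ) (Xstar : Set (EuclideanSpace ℝ (Fin m))) (hXne : Xstar.Nonempty)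
    (hFstar : ∀ z ∈ Xstar, F z = Fstar)
    (hFmin : ∀ y, Fstar ≤ F y)
    -- measurability / integrability of the data
    (hintf : ∀ z, Integrable (fun ω => f z ω) P)
    (hintg : ∀ z, Integrable (fun ω => g z ω) P)
    (hmeasdf : ∀ z, Measurable (fun ω => df z ω))
    (hmeasdg : ∀ z, Measurable (fun ω => dg z ω))
    (hintdfsq : ∀ z, Integrable (fun ω => ‖df z ω‖ ^ 2) P) :
    ∀ x : EuclideanSpace ℝ (Fin m), ∀ xbar ∈ Xstar,
      ∫ ω, ‖df x ω + dg x ω‖ ^ 2 ∂P ≤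
        4 * Lf * (F x - Fstar) + 4 * (Bg ^ 2 + ∫ ω, ‖df xbar ω‖ ^ 2 ∂P) := by
  intro x xbar hxbar
  have hLipf (ω : Ω) (z y : EuclideanSpace ℝ (Fin m)) : ‖df z ω - df y ω‖ ≤ Lf * ‖z - y‖ :=
    (hLip ω z y).trans (by gcongr; exact hLxi ω)
  have hintdf : Integrable (fun ω => df xbar ω) P :=
    ((memLp_two_iff_integrable_sq_norm (hmeasdf xbar).aestronglyMeasurable).2
      (hintdfsq xbar)).integrable one_le_two
  have hintinner : Integrable (fun ω => ⟪df xbar ω, x - xbar⟫) P := hintdf.inner_const _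
  set G : ℝ := ∫ ω, ⟪df xbar ω, x - xbar⟫ ∂P with hG
  have hFsplit (y : EuclideanSpace ℝ (Fin m)) : F y = ∫ ω, f y ω ∂P + ∫ ω, g y ω ∂P := by
    rw [hF, integral_add (hintf y) (hintg y)]
  have hopt : 0 ≤ G + ((∫ ω, g x ω ∂P) - ∫ ω, g xbar ω ∂P) := by
    have hstep (t : ℝ) (ht : 0 < t) (ht1 : t ≤ 1) :
        0 ≤ G + ((∫ ω, g x ω ∂P) - ∫ ω, g xbar ω ∂P) + t * (Lf / 2 * ‖x - xbar‖ ^ 2) := by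
      set y := xbar + t • (x - xbar) with hy
      have hfy : ∫ ω, f y ω ∂P ≤
          ∫ ω, (f xbar ω + t * ⟪df xbar ω, x - xbar⟫ + Lf / 2 * (t * ‖x - xbar‖) ^ 2) ∂P := by
        refine integral_mono (hintf y)
          (((hintf xbar).add (hintinner.const_mul t)).add (integrable_const _)) fun ω => ?_
        have := le_add_inner_add_sq_of_lipschitz_gradient (fun z => hgrad z ω) (hLipf ω) xbar
          (t • (x - xbar))
        rwa [real_inner_smul_right, norm_smul, Real.norm_of_nonneg ht.le] at this
      have hintl : Integrable (fun ω => f xbar ω + t * ⟪df xbar ω, x - xbar⟫) P :=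
        (hintf xbar).add (hintinner.const_mul t)
      rw [integral_add hintl (integrable_const _),
        integral_add (hintf xbar) (hintinner.const_mul t), integral_const_mul] at hfy
      simp only [integral_const, probReal_univ, one_smul] at hfy
      have hgy : ∫ ω, g y ω ∂P ≤ ∫ ω, ((1 - t) * g xbar ω + t * g x ω) ∂P := by
        refine integral_mono (hintg y)
          (((hintg xbar).const_mul _).add ((hintg x).const_mul t)) fun ω => ?_
        have := (hgconv ω).2 (Set.mem_univ xbar) (Set.mem_univ x) (sub_nonneg.2 ht1) ht.le
          (sub_add_cancel 1 t)
        have hy' : y = (1 - t) • xbar + t • x := by rw [hy]; module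
        rw [hy']
        simpa using this
      rw [integral_add ((hintg xbar).const_mul _) ((hintg x).const_mul t), integral_const_mul,
        integral_const_mul] at hgy
      have hmin := hFmin y
      rw [← hFstar xbar hxbar, hFsplit, hFsplit] at hmin
      refine nonneg_of_mul_nonneg_right (a := t) ?_ ht
      rw [← hG] at hfy
      linarith
    have hlim : Filter.Tendsto
        (fun t : ℝ => G + ((∫ ω, g x ω ∂P) - ∫ ω, g xbar ω ∂P) + t * (Lf / 2 * ‖x - xbar‖ ^ 2))
        (nhdsWithin 0 (Set.Ioi 0)) (nhds (G + ((∫ ω, g x ω ∂P) - ∫ ω, g xbar ω ∂P))) :=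
      (Continuous.tendsto' (by fun_prop) _ _ (by simp)).mono_left nhdsWithin_le_nhds
    refine ge_of_tendsto hlim ?_
    filter_upwards [Ioc_mem_nhdsGT (zero_lt_one (α := ℝ))] with t ht using hstep t ht.1 ht.2
  have hintA : Integrable (fun ω => f x ω - f xbar ω) P := (hintf x).sub (hintf xbar)
  have hintB : Integrable (fun ω => f x ω - f xbar ω - ⟪df xbar ω, x - xbar⟫) P :=
    hintA.sub hintinner
  have hintD : Integrable (fun ω => ‖df xbar ω‖ ^ 2 + Bg ^ 2) P :=
    (hintdfsq xbar).add (integrable_const _)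
  have hmain : ∫ ω, ‖df x ω + dg x ω‖ ^ 2 ∂P ≤
      ∫ ω, (4 * Lf * (f x ω - f xbar ω - ⟪df xbar ω, x - xbar⟫) +
        4 * (‖df xbar ω‖ ^ 2 + Bg ^ 2)) ∂P := by
    refine integral_mono_of_nonneg (.of_forall fun ω => sq_nonneg _)
      ((hintB.const_mul _).add (hintD.const_mul _)) (.of_forall fun ω => ?_)
    have h1 := (hfconv ω).sq_norm_gradient_sub_le hLf (fun z => hgrad z ω) (hLipf ω) x xbar
    have h2 := sq_norm_add_add_le (df x ω - df xbar ω) (df xbar ω) (dg x ω)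
    rw [sub_add_cancel] at h2
    have h3 : ‖dg x ω‖ ^ 2 ≤ Bg ^ 2 := pow_le_pow_left₀ (norm_nonneg _) (hgbdd x ω) 2
    dsimp only
    linarith
  rw [integral_add (hintB.const_mul _) (hintD.const_mul _), integral_const_mul,
    integral_const_mul, integral_sub hintA hintinner,
    integral_sub (hintf x) (hintf xbar), integral_add (hintdfsq xbar) (integrable_const _)] at hmain
  simp only [integral_const, probReal_univ, one_smul] at hmain
  rw [← hG] at hmain
  have hle : (∫ ω, f x ω ∂P) - (∫ ω, f xbar ω ∂P) - G ≤ F x - Fstar := by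
    rw [← hFstar xbar hxbar, hFsplit, hFsplit]
    linarith
  have := mul_le_mul_of_nonneg_left hle (by positivity : 0 ≤ 4 * Lf)
  linarith
end
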